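/- arXiv:2205.07435 — 3 statements merged into one kernel-verified Lean document; each statement's English description precedes it below -/
import Mathlib

section
/- Let n ≥ 2 be an integer, let p ∈ [1, n) and q ∈ [1, np/(n−p)]. There is a constant C depending only on n and p such that for every continuously differentiable function w : ℝⁿ → ℝ and every R > 0, one has (∫_{B_R} |w(x) − μ_R(w)|^q dx)^{1/q} ≤ C · R^{1 + n/q − n/p} · (∫_{B_R} |∇w(x)|^p dx)^{1/p}, where μ_R(w) = (∫_{ℝⁿ} θ_R w) / (∫_{ℝⁿ} θ_R). -/
open MeasureTheory Metric

/-- The cutoff function `θ_R` on `ℝⁿ`: equal to `1` on the ball of radius `R/2`,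
`0` outside the ball of radius `R`, and the explicit harmonic-type interpolation in between. -/
noncomputable def thetaR (n : ℕ) (R : ℝ) (x : EuclideanSpace ℝ (Fin n)) : ℝ :=
  if ‖x‖ ≤ R / 2 then 1
  else if R ≤ ‖x‖ then 0
  else if n = 2 then Real.log (R / ‖x‖) / Real.log 2
  else ((2 : ℝ) ^ ((n : ℤ) - 2) - 1)⁻¹ * ((‖x‖ / R) ^ ((2 : ℤ) - (n : ℤ)) - 1)

theorem enorm_le_lintegral_Icc_add_deriv {f : ℝ → ℝ} (hf : ContDiff ℝ 1 f) {c : ℝ} (hc : 0 < c) :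
    ‖f 0‖ₑ ≤ ∫⁻ t in Set.Icc 0 c, (ENNReal.ofReal c⁻¹ * ‖f t‖ₑ + ‖deriv f t‖ₑ) := by
  have hfm : Measurable f := hf.continuous.measurable
  set D := ∫⁻ s in Set.Icc 0 c, ‖deriv f s‖ₑ with hD
  have hone : ENNReal.ofReal c⁻¹ * ENNReal.ofReal c = 1 := by
    rw [← ENNReal.ofReal_mul (by positivity), inv_mul_cancel₀ hc.ne', ENNReal.ofReal_one]
  have hconst (a : ENNReal) : ∫⁻ _ in Set.Icc 0 c, ENNReal.ofReal c⁻¹ * a = a := by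
    rw [setLIntegral_const, Real.volume_Icc, sub_zero, mul_right_comm, hone, one_mul]
  have hbound (t : ℝ) (ht : t ∈ Set.Icc 0 c) : ‖f 0‖ₑ ≤ ‖f t‖ₑ + D := by
    have h1 : ‖f 0‖ₑ ≤ ‖f t‖ₑ + ‖f t - f 0‖ₑ := by
      calc ‖f 0‖ₑ = ‖f t - (f t - f 0)‖ₑ := by simp
        _ ≤ _ := enorm_sub_le
    refine h1.trans ?_
    gcongr
    refine (enorm_sub_le_lintegral_deriv_of_contDiffOn_Icc hf.contDiffOn ht.1).trans ?_
    exact lintegral_mono_set (Set.Icc_subset_Icc_right ht.2)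
  calc ‖f 0‖ₑ = ∫⁻ _ in Set.Icc 0 c, ENNReal.ofReal c⁻¹ * ‖f 0‖ₑ := (hconst _).symm
    _ ≤ ∫⁻ t in Set.Icc 0 c, (ENNReal.ofReal c⁻¹ * ‖f t‖ₑ + ENNReal.ofReal c⁻¹ * D) := by
        refine setLIntegral_mono' measurableSet_Icc fun t ht => ?_
        rw [← mul_add]
        gcongr
        exact hbound t ht
    _ = _ := by
        rw [lintegral_add_right _ measurable_const, hconst,
          lintegral_add_left (by fun_prop), hD]

/-- The Gagliardo-Nirenberg inequality with exponent one, on a set `S` every point of which can be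
moved inside `B` over a distance `c` along each coordinate direction. -/
theorem lintegral_enorm_rpow_le_of_segments {n : ℕ} {n' : ℝ} (hn : Real.HolderConjugate n n')
    {w : EuclideanSpace ℝ (Fin n) → ℝ} (hw : ContDiff ℝ 1 w)
    {S B : Set (EuclideanSpace ℝ (Fin n))} (hS : MeasurableSet S) (hB : MeasurableSet B)
    {c : ℝ} (hc : 0 < c)
    (hSB : ∀ x ∈ S, ∀ i, ∀ t ∈ Set.Icc 0 c, x + t • EuclideanSpace.single i 1 ∈ B) :
    ∫⁻ x in S, ‖w x‖ₑ ^ n' ≤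
      (∫⁻ x in B, (ENNReal.ofReal c⁻¹ * ‖w x‖ₑ + ‖fderiv ℝ w x‖ₑ)) ^ n' := by
  classical
  have hn1 : (1 : ℝ) < n := hn.lt
  have hcont := hw.continuous
  have hcont' : Continuous (fderiv ℝ w) := hw.continuous_fderiv one_ne_zero
  set g : EuclideanSpace ℝ (Fin n) → ENNReal :=
    fun x => ENNReal.ofReal c⁻¹ * ‖w x‖ₑ + ‖fderiv ℝ w x‖ₑ with hg
  have hgm : Measurable g := by fun_prop
  have key (x : EuclideanSpace ℝ (Fin n)) (hx : x ∈ S) (i : Fin n) :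
      ‖w x‖ₑ ≤ ∫⁻ s, B.indicator g (WithLp.toLp 2 (Function.update x.ofLp i s)) := by
    have hline : ContDiff ℝ 1 (fun t : ℝ => x + t • EuclideanSpace.single i (1 : ℝ)) := by fun_prop
    have hderiv (t : ℝ) : ‖deriv (fun t : ℝ => w (x + t • EuclideanSpace.single i (1 : ℝ))) t‖ₑ ≤
        ‖fderiv ℝ w (x + t • EuclideanSpace.single i 1)‖ₑ := by
      have h1 : HasDerivAt (fun t : ℝ => x + t • EuclideanSpace.single i (1 : ℝ))
          (EuclideanSpace.single i (1 : ℝ)) t := by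
        simpa using ((hasDerivAt_id t).smul_const (EuclideanSpace.single i (1 : ℝ))).const_add x
      have h2 := ((hw.differentiable one_ne_zero).differentiableAt.hasFDerivAt
        (x := x + t • EuclideanSpace.single i (1 : ℝ))).comp_hasDerivAt t h1
      have h3 : deriv (fun t : ℝ => w (x + t • EuclideanSpace.single i (1 : ℝ))) t = _ := h2.deriv
      rw [h3]
      refine (ContinuousLinearMap.le_opENorm _ _).trans ?_
      simp [enorm]
    have hupd (t : ℝ) : x + t • EuclideanSpace.single i (1 : ℝ) =
        WithLp.toLp 2 (Function.update x.ofLp i (x i + t)) := by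
      ext j
      by_cases h : j = i
      · subst h; simp
      · simp [h]
    calc ‖w x‖ₑ = ‖w (x + (0 : ℝ) • EuclideanSpace.single i (1 : ℝ))‖ₑ := by simp
      _ ≤ _ := enorm_le_lintegral_Icc_add_deriv (hw.comp hline) hc
      _ ≤ ∫⁻ t in Set.Icc 0 c, B.indicator g (x + t • EuclideanSpace.single i (1 : ℝ)) := by
          refine setLIntegral_mono' measurableSet_Icc fun t ht => ?_
          rw [Set.indicator_of_mem (hSB x hx i t ht)]
          exact add_le_add le_rfl (hderiv t)
      _ ≤ ∫⁻ t, B.indicator g (x + t • EuclideanSpace.single i (1 : ℝ)) :=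
          setLIntegral_le_lintegral _ _
      _ = ∫⁻ t, B.indicator g (WithLp.toLp 2 (Function.update x.ofLp i (x i + t))) := by
          simp_rw [hupd]
      _ = _ := lintegral_add_left_eq_self
          (fun s => B.indicator g (WithLp.toLp 2 (Function.update x.ofLp i s))) (x i)
  have hmp := PiLp.volume_preserving_toLp (Fin n)
  have hemb := (MeasurableEquiv.toLp 2 (Fin n → ℝ)).measurableEmbedding
  have hgi : Measurable (B.indicator g) := hgm.indicator hB
  have hexp : n' = 1 / ((n : ℝ) - 1) * n := by
    rw [hn.conjugate_eq]; field_simp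
  rw [← lintegral_indicator hS, ← lintegral_indicator hB, ← hmp.lintegral_comp_emb hemb,
    ← hmp.lintegral_comp_emb hemb]
  have hgrid := lintegral_prod_lintegral_pow_le (ι := Fin n) (A := fun _ => ℝ)
    (fun _ => (volume : Measure ℝ)) (p := n') (by simpa using hn)
    (hgi.comp (WithLp.measurable_toLp 2 (Fin n → ℝ)))
  refine le_trans (lintegral_mono fun x => ?_) hgrid
  simp only [Fintype.card_fin, Function.comp_apply]
  by_cases hx : WithLp.toLp 2 x ∈ S
  · rw [Set.indicator_of_mem hx, hexp, ENNReal.rpow_mul, ENNReal.rpow_natCast]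
    calc (‖w (WithLp.toLp 2 x)‖ₑ ^ (1 / ((n : ℝ) - 1))) ^ n
        = ∏ _i : Fin n, ‖w (WithLp.toLp 2 x)‖ₑ ^ (1 / ((n : ℝ) - 1)) := by simp
      _ ≤ _ := by
        refine Finset.prod_le_prod' fun i _ => ?_
        refine ENNReal.rpow_le_rpow (key _ hx i) ?_
        have : 0 < (n : ℝ) - 1 := by linarith
        positivity
  · rw [Set.indicator_of_notMem hx]
    exact zero_le

theorem add_smul_single_mem_ball {n : ℕ} {δ : ℝ} {x : EuclideanSpace ℝ (Fin n)}
    (hx : x ∈ ball (0 : EuclideanSpace ℝ (Fin n)) 1) (hx' : ‖x‖ < 1 / 2 ∨ ∀ i, x i < -δ)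
    (i : Fin n) {t : ℝ} (ht : t ∈ Set.Icc 0 (min (1 / 2) δ)) :
    x + t • EuclideanSpace.single i 1 ∈ ball (0 : EuclideanSpace ℝ (Fin n)) 1 := by
  rw [mem_ball_zero_iff] at hx ⊢
  have ht1 : t ≤ 1 / 2 := ht.2.trans (min_le_left _ _)
  have ht2 : t ≤ δ := ht.2.trans (min_le_right _ _)
  have hnorm : ‖t • EuclideanSpace.single i (1 : ℝ)‖ = t := by
    simp [norm_smul, abs_of_nonneg ht.1]
  rcases hx' with h | h
  · linarith [norm_add_le x (t • EuclideanSpace.single i (1 : ℝ))]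
  · have hsq : ‖x + t • EuclideanSpace.single i (1 : ℝ)‖ ^ 2 = ‖x‖ ^ 2 + 2 * (t * x i) + t ^ 2 := by
      rw [norm_add_sq_real, hnorm, real_inner_smul_right, EuclideanSpace.inner_single_right]
      simp
    have h1 : t * x i ≤ t * -δ := mul_le_mul_of_nonneg_left (h i).le ht.1
    have h2 : t * t ≤ t * δ := mul_le_mul_of_nonneg_left ht2 ht.1
    have h3 : 0 ≤ t * δ := mul_nonneg ht.1 (ht.1.trans ht2)
    refine lt_of_le_of_lt ?_ hx
    refine le_of_sq_le_sq ?_ (norm_nonneg _)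
    rw [hsq]
    nlinarith

theorem isOpen_norm_lt_or_forall_coord_lt (n : ℕ) (r δ : ℝ) :
    IsOpen {x : EuclideanSpace ℝ (Fin n) | ‖x‖ < r ∨ ∀ i, x i < -δ} := by
  have h : {x : EuclideanSpace ℝ (Fin n) | ‖x‖ < r ∨ ∀ i, x i < -δ} =
      {x | ‖x‖ < r} ∪ ⋂ i, {x | x i < -δ} := by
    ext; simp
  rw [h]
  exact (isOpen_lt continuous_norm continuous_const).union
    (isOpen_iInter_of_finite fun i => isOpen_lt (by fun_prop) continuous_const)

theorem exists_finset_isometry_cover {n : ℕ} (hn : 0 < n) :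
    ∃ δ : ℝ, 0 < δ ∧ ∃ T : Finset (EuclideanSpace ℝ (Fin n) ≃ₗᵢ[ℝ] EuclideanSpace ℝ (Fin n)),
      ∀ x ∈ closedBall (0 : EuclideanSpace ℝ (Fin n)) 1,
        ∃ A ∈ T, ‖A x‖ < 1 / 2 ∨ ∀ i, A x i < -δ := by
  have hn0 : (0 : ℝ) < n := by exact_mod_cast hn
  have hs : 0 < √(n : ℝ) := Real.sqrt_pos.2 hn0
  refine ⟨1 / (4 * √n), by positivity, ?_⟩
  set O : Set (EuclideanSpace ℝ (Fin n)) :=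
    {x | ‖x‖ < 1 / 2 ∨ ∀ i, x i < -(1 / (4 * √(n : ℝ)))} with hO
  have hOopen : IsOpen O := isOpen_norm_lt_or_forall_coord_lt n _ _
  obtain ⟨T, hT⟩ := (isCompact_closedBall (0 : EuclideanSpace ℝ (Fin n)) 1).elim_finite_subcover
    (fun A : EuclideanSpace ℝ (Fin n) ≃ₗᵢ[ℝ] EuclideanSpace ℝ (Fin n) => A ⁻¹' O)
    (fun A => hOopen.preimage A.continuous) (fun x hx => by
      rw [Set.mem_iUnion]
      rcases lt_or_ge ‖x‖ (1 / 2) with h | h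
      · exact ⟨LinearIsometryEquiv.refl ℝ _, Or.inl h⟩
      · set z : EuclideanSpace ℝ (Fin n) := WithLp.toLp 2 fun _ => -(‖x‖ / √(n : ℝ)) with hz
        have hzx : ‖z‖ = ‖x‖ := by
          rw [EuclideanSpace.norm_eq z]
          simp only [hz, norm_neg, Finset.sum_const, Finset.card_univ, Fintype.card_fin, norm_div,
            abs_norm, div_pow, nsmul_eq_mul, Real.norm_eq_abs, abs_of_pos hs,
            Real.sq_sqrt hn0.le]
          rw [mul_div_cancel₀ _ hn0.ne', Real.sqrt_sq (norm_nonneg _)]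
        refine ⟨(Submodule.span ℝ {x - z})ᗮ.reflection, Or.inr fun i => ?_⟩
        rw [Submodule.reflection_sub hzx.symm]
        change -(‖x‖ / √(n : ℝ)) < _
        rw [neg_lt_neg_iff, div_lt_div_iff₀ (by positivity) hs]
        nlinarith)
  refine ⟨T, fun x hx => ?_⟩
  simpa [hO] using hT hx

/-- The Gagliardo-Nirenberg inequality with exponent one on the unit ball. -/
theorem exists_lintegral_ball_enorm_rpow_le {n : ℕ} {n' : ℝ} (hn : Real.HolderConjugate n n') :
    ∃ C : NNReal, ∀ w : EuclideanSpace ℝ (Fin n) → ℝ, ContDiff ℝ 1 w →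
      (∫⁻ x in ball (0 : EuclideanSpace ℝ (Fin n)) 1, ‖w x‖ₑ ^ n') ^ (1 / n') ≤
        C * ∫⁻ x in ball (0 : EuclideanSpace ℝ (Fin n)) 1, (‖w x‖ₑ + ‖fderiv ℝ w x‖ₑ) := by
  have hn0 : 0 < n := by exact_mod_cast hn.pos
  have hn'0 : 0 < n' := hn.symm.pos
  obtain ⟨δ, hδ, T, hT⟩ := exists_finset_isometry_cover hn0
  set B := ball (0 : EuclideanSpace ℝ (Fin n)) 1 with hB
  set c := min (1 / 2) δ with hc
  have hcpos : 0 < c := lt_min (by norm_num) hδ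
  set O : Set (EuclideanSpace ℝ (Fin n)) := {x | ‖x‖ < 1 / 2 ∨ ∀ i, x i < -δ} with hO
  have hOopen : IsOpen O := isOpen_norm_lt_or_forall_coord_lt n _ _
  have hball (A : EuclideanSpace ℝ (Fin n) ≃ₗᵢ[ℝ] EuclideanSpace ℝ (Fin n)) : A ⁻¹' B = B := by
    ext x; simp [hB]
  refine ⟨(T.card : NNReal) ^ (1 / n') * (c⁻¹.toNNReal + 1), fun w hw => ?_⟩
  have hcont := hw.continuous
  have hcont' : Continuous (fderiv ℝ w) := hw.continuous_fderiv one_ne_zero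
  set I := ∫⁻ x in B, (‖w x‖ₑ + ‖fderiv ℝ w x‖ₑ) with hI
  have hpiece (A : EuclideanSpace ℝ (Fin n) ≃ₗᵢ[ℝ] EuclideanSpace ℝ (Fin n)) :
      ∫⁻ x in A ⁻¹' (O ∩ B), ‖w x‖ₑ ^ n' ≤ ((c⁻¹.toNNReal + 1 : NNReal) * I) ^ n' := by
    have hmp := A.measurePreserving
    have hemb := A.toHomeomorph.measurableEmbedding
    have hv : ContDiff ℝ 1 (fun y => w (A.symm y)) := hw.comp A.symm.contDiff
    have hfd (x : EuclideanSpace ℝ (Fin n)) :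
        ‖fderiv ℝ (fun y => w (A.symm y)) (A x)‖ₑ = ‖fderiv ℝ w x‖ₑ := by
      have h := (A.symm.toContinuousLinearEquiv).comp_right_fderiv (f := w) (x := A x)
      have h' : fderiv ℝ (fun y => w (A.symm y)) (A x) = (fderiv ℝ w (A.symm (A x))).comp
        (A.symm.toContinuousLinearEquiv : _ →L[ℝ] _) := h
      rw [h', A.symm_apply_apply, ← ofReal_norm, ← ofReal_norm]
      congr 1
      exact ContinuousLinearMap.opNorm_comp_linearIsometryEquiv _ A.symm
    have h1 := lintegral_enorm_rpow_le_of_segments hn hv (S := O ∩ B) (B := B)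
      (hOopen.measurableSet.inter measurableSet_ball) measurableSet_ball hcpos
      (fun x hx i t ht => add_smul_single_mem_ball hx.2 hx.1 i ht)
    rw [← hmp.setLIntegral_comp_preimage_emb hemb _ (O ∩ B),
      ← hmp.setLIntegral_comp_preimage_emb hemb _ B, hball] at h1
    simp only [A.symm_apply_apply, hfd] at h1
    refine h1.trans ?_
    gcongr
    rw [hI, ← lintegral_const_mul _ (by fun_prop)]
    refine lintegral_mono fun x => ?_
    simp only [mul_add, ENNReal.coe_add, ENNReal.coe_one, add_mul, one_mul]
    gcongr
    · exact le_self_add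
    · exact le_add_self
  have hcover : B ⊆ ⋃ A : T, A.1 ⁻¹' (O ∩ B) := fun x hx => by
    obtain ⟨A, hA, h⟩ := hT x (ball_subset_closedBall hx)
    simp only [Set.mem_iUnion]
    exact ⟨⟨A, hA⟩, h, by rw [← hball A] at hx; exact hx⟩
  calc (∫⁻ x in B, ‖w x‖ₑ ^ n') ^ (1 / n')
      ≤ (T.card * ((c⁻¹.toNNReal + 1 : NNReal) * I) ^ n') ^ (1 / n') := by
        gcongr
        calc ∫⁻ x in B, ‖w x‖ₑ ^ n' ≤ ∫⁻ x in ⋃ A : T, A.1 ⁻¹' (O ∩ B), ‖w x‖ₑ ^ n' :=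
              lintegral_mono_set hcover
          _ ≤ ∑ A ∈ T, ∫⁻ x in A ⁻¹' (O ∩ B), ‖w x‖ₑ ^ n' := by
              rw [← Finset.sum_coe_sort T]
              exact (lintegral_iUnion_le _ _).trans_eq (tsum_fintype _)
          _ ≤ ∑ A ∈ T, ((c⁻¹.toNNReal + 1 : NNReal) * I) ^ n' :=
              Finset.sum_le_sum fun A _ => hpiece A
          _ = _ := by simp
    _ = _ := by
        rw [ENNReal.mul_rpow_of_nonneg _ _ (by positivity), ← ENNReal.rpow_mul,
          mul_one_div_cancel hn'0.ne', ENNReal.rpow_one, ← mul_assoc, ENNReal.coe_mul,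
          ENNReal.coe_rpow_of_nonneg _ (by positivity)]
        simp

theorem lintegral_ball_enorm_rpow_ne_top {n : ℕ} {f : EuclideanSpace ℝ (Fin n) → ℝ}
    (hf : Continuous f) {s : ℝ} (hs : 0 ≤ s) :
    ∫⁻ x in ball (0 : EuclideanSpace ℝ (Fin n)) 1, ‖f x‖ₑ ^ s ≠ ⊤ := by
  have hc : Continuous fun x => ‖f x‖ ^ s := hf.norm.rpow_const fun _ => Or.inr hs
  have h := ((hc.continuousOn.integrableOn_compact (μ := volume) (isCompact_closedBall
    (0 : EuclideanSpace ℝ (Fin n)) 1)).mono_set ball_subset_closedBall).2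
  simp only [HasFiniteIntegral, Real.enorm_rpow_of_nonneg (norm_nonneg _) hs, enorm_norm] at h
  exact h.ne

/-- The Sobolev inequality on the unit ball. -/
theorem exists_eLpNorm'_ball_le {n : ℕ} (hn : 2 ≤ n) {p : ℝ} (hp1 : 1 ≤ p) (hpn : p < n) :
    ∃ C : NNReal, ∀ w : EuclideanSpace ℝ (Fin n) → ℝ, ContDiff ℝ 1 w →
      eLpNorm' w (n * p / (n - p)) (volume.restrict (ball 0 1)) ≤
        C * (eLpNorm' w p (volume.restrict (ball 0 1)) +
          eLpNorm' (fderiv ℝ w) p (volume.restrict (ball 0 1))) := by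
  have hn2 : (2 : ℝ) ≤ n := by exact_mod_cast hn
  have hn1 : (0 : ℝ) < n - 1 := by linarith
  have hnp : (0 : ℝ) < n - p := by linarith
  have hconj : Real.HolderConjugate n (Real.conjExponent n) := .conjExponent (by linarith)
  obtain ⟨C, hC⟩ := exists_lintegral_ball_enorm_rpow_le hconj
  set n' := Real.conjExponent n with hn'
  set ν := volume.restrict (ball (0 : EuclideanSpace ℝ (Fin n)) 1) with hν
  rcases hp1.eq_or_lt with rfl | hp
  · refine ⟨C, fun w hw => ?_⟩
    have hcont := hw.continuous
    have hcont' : Continuous (fderiv ℝ w) := hw.continuous_fderiv one_ne_zero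
    have h := hC w hw
    rw [lintegral_add_left (by fun_prop)] at h
    have he : (n : ℝ) * 1 / (n - 1) = n' := by rw [mul_one]; rfl
    rw [he]
    simpa [eLpNorm'] using h
  · have hp0 : 0 < p := by linarith
    set q := Real.conjExponent p with hq
    have hpq : Real.HolderConjugate p q := .conjExponent hp
    set r := (n : ℝ) * p / (n - p) with hr
    have hr0 : 0 < r := by positivity
    set γ : NNReal := ⟨p * (n - 1) / (n - p), by positivity⟩ with hγ
    have hγr : (γ : ℝ) = p * (n - 1) / (n - p) := rfl
    have hγ1 : 1 < (γ : ℝ) := by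
      rw [hγr, one_lt_div hnp]
      nlinarith
    have hγn : (γ : ℝ) * n' = r := by
      rw [hγr, hn', Real.conjExponent, hr]
      field_simp
    have hγq : ((γ : ℝ) - 1) * q = r := by
      have h1 : p - 1 ≠ 0 := by linarith
      have h2 : (γ : ℝ) - 1 = n * (p - 1) / (n - p) := by
        rw [hγr]; field_simp; ring
      rw [h2, hq, Real.conjExponent, hr]
      field_simp
    have hexp : 1 / n' - 1 / q = 1 / r := by
      have h1 : p - 1 ≠ 0 := by linarith
      rw [hn', hq, Real.conjExponent, Real.conjExponent, hr]
      field_simp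
      ring
    refine ⟨C * γ, fun w hw => ?_⟩
    have hcont := hw.continuous
    have hcont' : Continuous (fderiv ℝ w) := hw.continuous_fderiv one_ne_zero
    set K := ∫⁻ x, ‖w x‖ₑ ^ r ∂ν with hK
    have hKtop : K ≠ ⊤ := lintegral_ball_enorm_rpow_ne_top hcont hr0.le
    by_cases hK0 : K = 0
    · rw [eLpNorm', ← hK, hK0, ENNReal.zero_rpow_of_pos (by positivity)]
      exact zero_le
    have hv : ContDiff ℝ 1 fun x => ‖w x‖ ^ (γ : ℝ) := hw.norm_rpow hγ1
    have hγ0 : (0 : ℝ) ≤ γ - 1 := by linarith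
    have holder {F : Type} [NormedAddCommGroup F] [MeasurableSpace F] [BorelSpace F]
        {f : EuclideanSpace ℝ (Fin n) → F} (hf : Continuous f) :
        ∫⁻ x, ‖w x‖ₑ ^ ((γ : ℝ) - 1) * ‖f x‖ₑ ∂ν ≤ K ^ (1 / q) * eLpNorm' f p ν := by
      have h := ENNReal.lintegral_mul_le_Lp_mul_Lq ν hpq.symm
        (f := fun x => ‖w x‖ₑ ^ ((γ : ℝ) - 1)) (g := fun x => ‖f x‖ₑ)
        (by fun_prop) (by fun_prop)
      simp only [← ENNReal.rpow_mul, hγq] at h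
      exact h
    have hmain : K ^ (1 / n') ≤ K ^ (1 / q) *
        (C * γ * (eLpNorm' w p ν + eLpNorm' (fderiv ℝ w) p ν)) := by
      calc K ^ (1 / n') = (∫⁻ x, ‖‖w x‖ ^ (γ : ℝ)‖ₑ ^ n' ∂ν) ^ (1 / n') := by
            simp only [Real.enorm_rpow_of_nonneg (norm_nonneg _) γ.coe_nonneg, enorm_norm,
              ← ENNReal.rpow_mul, hγn, hK]
        _ ≤ C * ∫⁻ x, (‖‖w x‖ ^ (γ : ℝ)‖ₑ + ‖fderiv ℝ (fun x => ‖w x‖ ^ (γ : ℝ)) x‖ₑ) ∂ν :=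
            hC _ hv
        _ ≤ C * ∫⁻ x, (γ * (‖w x‖ₑ ^ ((γ : ℝ) - 1) * ‖w x‖ₑ) +
              γ * (‖w x‖ₑ ^ ((γ : ℝ) - 1) * ‖fderiv ℝ w x‖ₑ)) ∂ν := by
            gcongr with x
            · rw [Real.enorm_rpow_of_nonneg (norm_nonneg _) γ.coe_nonneg, enorm_norm]
              calc ‖w x‖ₑ ^ (γ : ℝ) = ‖w x‖ₑ ^ ((γ : ℝ) - 1 + 1) := by rw [sub_add_cancel]
                _ = 1 * (‖w x‖ₑ ^ ((γ : ℝ) - 1) * ‖w x‖ₑ) := by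
                  rw [ENNReal.rpow_add_of_nonneg _ _ hγ0 zero_le_one, ENNReal.rpow_one, one_mul]
                _ ≤ _ := by
                  gcongr
                  exact_mod_cast hγ1.le
            · rw [← mul_assoc]
              exact enorm_fderiv_norm_rpow_le (hw.differentiable one_ne_zero) hγ1
        _ = C * (γ * ∫⁻ x, ‖w x‖ₑ ^ ((γ : ℝ) - 1) * ‖w x‖ₑ ∂ν +
              γ * ∫⁻ x, ‖w x‖ₑ ^ ((γ : ℝ) - 1) * ‖fderiv ℝ w x‖ₑ ∂ν) := by
            rw [lintegral_add_left (by fun_prop), lintegral_const_mul _ (by fun_prop),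
              lintegral_const_mul _ (by fun_prop)]
        _ ≤ C * (γ * (K ^ (1 / q) * eLpNorm' w p ν) +
              γ * (K ^ (1 / q) * eLpNorm' (fderiv ℝ w) p ν)) := by
            gcongr
            · exact holder hcont
            · exact holder hcont'
        _ = _ := by ring
    have hKq0 : K ^ (1 / q) ≠ 0 := (ENNReal.rpow_pos (pos_iff_ne_zero.2 hK0) hKtop).ne'
    have hKqtop : K ^ (1 / q) ≠ ⊤ := ENNReal.rpow_ne_top_of_nonneg
      (one_div_nonneg.2 hpq.symm.nonneg) hKtop
    rw [eLpNorm', ← hK, ← hexp, ENNReal.rpow_sub _ _ hK0 hKtop]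
    refine ENNReal.div_le_of_le_mul' ?_
    rw [ENNReal.coe_mul]
    exact hmain

theorem lintegral_comp_const_add_smul {n : ℕ} {g : EuclideanSpace ℝ (Fin n) → ENNReal}
    (hg : Measurable g) (a : EuclideanSpace ℝ (Fin n)) {t : ℝ} (ht : t ≠ 0) :
    ∫⁻ y, g (a + t • y) = ENNReal.ofReal |(t ^ n)⁻¹| * ∫⁻ y, g y := by
  have h := Measure.map_addHaar_smul (volume : Measure (EuclideanSpace ℝ (Fin n))) ht
  rw [finrank_euclideanSpace_fin] at h
  calc ∫⁻ y, g (a + t • y)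
      = ∫⁻ z, g (a + z) ∂(Measure.map (t • ·) (volume : Measure (EuclideanSpace ℝ (Fin n)))) :=
        (lintegral_map (f := fun z => g (a + z)) (by fun_prop) (by fun_prop)).symm
    _ = _ := by
        rw [h, lintegral_smul_measure, lintegral_add_left_eq_self g a, smul_eq_mul]

theorem lintegral_comp_const_add_smul_le {n : ℕ} {g : EuclideanSpace ℝ (Fin n) → ENNReal}
    (hg : Measurable g) (a : EuclideanSpace ℝ (Fin n)) {t : ℝ} (ht : 1 / 2 ≤ t) :
    ∫⁻ y, g (a + t • y) ≤ 2 ^ n * ∫⁻ y, g y := by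
  have ht0 : 0 < t := by linarith
  rw [lintegral_comp_const_add_smul hg a ht0.ne']
  gcongr
  rw [abs_of_pos (by positivity), ← inv_pow, ENNReal.ofReal_pow (by positivity)]
  gcongr
  rw [← ENNReal.ofReal_ofNat]
  refine ENNReal.ofReal_le_ofReal ?_
  rw [inv_le_comm₀ ht0 two_pos]
  linarith

theorem lintegral_lintegral_comp_lineMap_le {n : ℕ} {g : EuclideanSpace ℝ (Fin n) → ENNReal}
    (hg : Measurable g) (B : Set (EuclideanSpace ℝ (Fin n))) (t : ℝ) :
    ∫⁻ x in B, ∫⁻ y in B, g (x + t • (y - x)) ≤ 2 ^ n * volume B * ∫⁻ y, g y := by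
  have hswap : ∫⁻ x in B, ∫⁻ y in B, g (x + t • (y - x)) =
      ∫⁻ y in B, ∫⁻ x in B, g (x + t • (y - x)) :=
    lintegral_lintegral_swap (by unfold Function.uncurry; fun_prop)
  have hconst : ∫⁻ _ in B, 2 ^ n * ∫⁻ y, g y = 2 ^ n * volume B * ∫⁻ y, g y := by
    rw [setLIntegral_const]; ring
  rcases le_total (1 / 2) t with ht | ht
  · rw [← hconst]
    refine lintegral_mono fun x => (setLIntegral_le_lintegral _ _).trans ?_
    have h (y : EuclideanSpace ℝ (Fin n)) : x + t • (y - x) = (x - t • x) + t • y := by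
      rw [smul_sub]; abel
    simp only [h]
    exact lintegral_comp_const_add_smul_le hg _ ht
  · rw [hswap, ← hconst]
    refine lintegral_mono fun y => (setLIntegral_le_lintegral _ _).trans ?_
    have h (x : EuclideanSpace ℝ (Fin n)) : x + t • (y - x) = t • y + (1 - t) • x := by
      rw [smul_sub, sub_smul, one_smul]; abel
    simp only [h]
    exact lintegral_comp_const_add_smul_le hg _ (by linarith)

theorem lintegral_lintegral_ball_enorm_sub_rpow_le {n : ℕ} {p : ℝ} (hp1 : 1 ≤ p)
    {w : EuclideanSpace ℝ (Fin n) → ℝ} (hw : ContDiff ℝ 1 w) :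
    ∫⁻ x in ball (0 : EuclideanSpace ℝ (Fin n)) 1,
        ∫⁻ y in ball (0 : EuclideanSpace ℝ (Fin n)) 1, ‖w x - w y‖ₑ ^ p ≤
      2 ^ p * (2 ^ n * volume (ball (0 : EuclideanSpace ℝ (Fin n)) 1)) *
        ∫⁻ x in ball (0 : EuclideanSpace ℝ (Fin n)) 1, ‖fderiv ℝ w x‖ₑ ^ p := by
  set B := ball (0 : EuclideanSpace ℝ (Fin n)) 1 with hB
  have hp0 : 0 < p := by linarith
  have hcont' : Continuous (fderiv ℝ w) := hw.continuous_fderiv one_ne_zero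
  set g : EuclideanSpace ℝ (Fin n) → ENNReal := B.indicator fun x => ‖fderiv ℝ w x‖ₑ ^ p with hg
  have hgm : Measurable g := Measurable.indicator (by fun_prop) measurableSet_ball
  have hI : IsProbabilityMeasure (volume.restrict (Set.Icc (0 : ℝ) 1)) := ⟨by simp⟩
  have hpt (x y : EuclideanSpace ℝ (Fin n)) (hx : x ∈ B) (hy : y ∈ B) :
      ‖w x - w y‖ₑ ^ p ≤ 2 ^ p * ∫⁻ t in Set.Icc (0 : ℝ) 1, g (x + t • (y - x)) := by
    have hline : ContDiff ℝ 1 (fun t : ℝ => x + t • (y - x)) := by fun_prop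
    have hderiv (t : ℝ) : ‖deriv (fun t : ℝ => w (x + t • (y - x))) t‖ₑ ≤
        2 * ‖fderiv ℝ w (x + t • (y - x))‖ₑ := by
      have h1 : HasDerivAt (fun t : ℝ => x + t • (y - x)) (y - x) t := by
        simpa using ((hasDerivAt_id t).smul_const (y - x)).const_add x
      have h2 := ((hw.differentiable one_ne_zero).differentiableAt.hasFDerivAt
        (x := x + t • (y - x))).comp_hasDerivAt t h1
      have h3 : deriv (fun t : ℝ => w (x + t • (y - x))) t = _ := h2.deriv
      rw [h3]
      refine (ContinuousLinearMap.le_opENorm _ _).trans ?_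
      rw [mul_comm]
      gcongr
      rw [← ofReal_norm]
      have h4 : ‖y - x‖ ≤ 2 := by
        rw [hB, mem_ball_zero_iff] at hx hy
        linarith [norm_sub_le y x]
      exact (ENNReal.ofReal_le_ofReal h4).trans_eq (by simp)
    have h1 := enorm_sub_le_lintegral_deriv_of_contDiffOn_Icc
      (hw.comp hline).contDiffOn (zero_le_one' ℝ)
    have hcm : Continuous fun t : ℝ => fderiv ℝ w (x + t • (y - x)) := hcont'.comp hline.continuous
    calc ‖w x - w y‖ₑ ^ p = ‖w y - w x‖ₑ ^ p := by rw [← enorm_neg, neg_sub]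
      _ ≤ (∫⁻ t in Set.Icc (0 : ℝ) 1, 2 * ‖fderiv ℝ w (x + t • (y - x))‖ₑ) ^ p := by
          gcongr
          refine le_trans ?_ (h1.trans (lintegral_mono fun t => hderiv t))
          simp
      _ = 2 ^ p * (∫⁻ t in Set.Icc (0 : ℝ) 1, ‖fderiv ℝ w (x + t • (y - x))‖ₑ) ^ p := by
          rw [lintegral_const_mul _ (by fun_prop), ENNReal.mul_rpow_of_nonneg _ _ hp0.le]
      _ ≤ 2 ^ p * ∫⁻ t in Set.Icc (0 : ℝ) 1, ‖fderiv ℝ w (x + t • (y - x))‖ₑ ^ p := by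
          gcongr
          have h := eLpNorm'_le_eLpNorm'_of_exponent_le one_pos hp1
            (volume.restrict (Set.Icc (0 : ℝ) 1)) hcm.aestronglyMeasurable
          simp only [eLpNorm', ENNReal.rpow_one, div_one] at h
          rwa [one_div, ENNReal.le_rpow_inv_iff hp0] at h
      _ = _ := by
          congr 1
          refine setLIntegral_congr_fun measurableSet_Icc fun t ht => ?_
          have hmem : x + t • (y - x) ∈ B :=
            (convex_ball (0 : EuclideanSpace ℝ (Fin n)) 1).add_smul_sub_mem hx hy ht
          simp only [hg, Set.indicator_of_mem hmem]
  calc ∫⁻ x in B, ∫⁻ y in B, ‖w x - w y‖ₑ ^ p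
      ≤ ∫⁻ x in B, ∫⁻ y in B, 2 ^ p * ∫⁻ t in Set.Icc (0 : ℝ) 1, g (x + t • (y - x)) :=
        setLIntegral_mono' measurableSet_ball fun x hx =>
          setLIntegral_mono' measurableSet_ball fun y hy => hpt x y hx hy
    _ = 2 ^ p * ∫⁻ t in Set.Icc (0 : ℝ) 1, ∫⁻ x in B, ∫⁻ y in B, g (x + t • (y - x)) := by
        have h1 (x : EuclideanSpace ℝ (Fin n)) :
            ∫⁻ y in B, 2 ^ p * ∫⁻ t in Set.Icc (0 : ℝ) 1, g (x + t • (y - x)) =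
              2 ^ p * ∫⁻ t in Set.Icc (0 : ℝ) 1, ∫⁻ y in B, g (x + t • (y - x)) := by
          rw [lintegral_const_mul, lintegral_lintegral_swap]
          · unfold Function.uncurry; fun_prop
          · refine Measurable.lintegral_prod_right' (f := fun z : _ × ℝ => g (x + z.2 • (z.1 - x))) ?_
            fun_prop
        simp only [h1]
        have hm : Measurable fun z : EuclideanSpace ℝ (Fin n) × ℝ =>
            ∫⁻ y in B, g (z.1 + z.2 • (y - z.1)) :=
          Measurable.lintegral_prod_right'
            (f := fun z : (EuclideanSpace ℝ (Fin n) × ℝ) × EuclideanSpace ℝ (Fin n) =>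
              g (z.1.1 + z.1.2 • (z.2 - z.1.1))) (by fun_prop)
        rw [lintegral_const_mul, lintegral_lintegral_swap]
        · exact hm.aemeasurable
        · exact hm.lintegral_prod_right'
    _ ≤ 2 ^ p * ∫⁻ _ in Set.Icc (0 : ℝ) 1, 2 ^ n * volume B * ∫⁻ y, g y := by
        gcongr with t
        exact lintegral_lintegral_comp_lineMap_le hgm B t
    _ = _ := by
        rw [lintegral_const, measure_univ, mul_one, hg, lintegral_indicator measurableSet_ball,
          ← mul_assoc]

/-- A Poincaré inequality on the unit ball, for a weighted mean. -/
theorem exists_eLpNorm'_ball_sub_mean_le {n : ℕ} {p : ℝ} (hp1 : 1 ≤ p)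
    {θ : EuclideanSpace ℝ (Fin n) → ℝ} (hθm : Measurable θ) (hθ1 : ∀ x, ‖θ x‖ ≤ 1)
    (hθ0 : ∀ x, x ∉ ball (0 : EuclideanSpace ℝ (Fin n)) 1 → θ x = 0) (hθ : 0 < ∫ x, θ x) :
    ∃ C : NNReal, ∀ w : EuclideanSpace ℝ (Fin n) → ℝ, ContDiff ℝ 1 w →
      eLpNorm' (fun x => w x - (∫ y, θ y * w y) / ∫ y, θ y) p (volume.restrict (ball 0 1)) ≤
        C * eLpNorm' (fderiv ℝ w) p (volume.restrict (ball 0 1)) := by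
  have hp0 : 0 < p := by linarith
  set B := ball (0 : EuclideanSpace ℝ (Fin n)) 1 with hB
  set V := volume B with hV
  have hVtop : V ≠ ⊤ := measure_ball_lt_top.ne
  set m := ∫ x, θ x with hm
  set M : ENNReal := ENNReal.ofReal m⁻¹ * V ^ (1 / 1 - 1 / p) with hM
  have hexp : 0 ≤ 1 / 1 - 1 / p := by
    rw [div_one, sub_nonneg, div_le_one hp0]
    exact hp1
  have hMtop : M ≠ ⊤ :=
    ENNReal.mul_ne_top ENNReal.ofReal_ne_top (ENNReal.rpow_ne_top_of_nonneg hexp hVtop)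
  set D : ENNReal := M ^ p * (2 ^ p * (2 ^ n * V)) with hD
  have hDtop : D ≠ ⊤ := by finiteness
  refine ⟨(D ^ (1 / p)).toNNReal, fun w hw => ?_⟩
  rw [ENNReal.coe_toNNReal (ENNReal.rpow_ne_top_of_nonneg (by positivity) hDtop)]
  have hcont := hw.continuous
  have hsupp {f : EuclideanSpace ℝ (Fin n) → ℝ} : (∫ y in B, θ y * f y) = ∫ y, θ y * f y :=
    setIntegral_eq_integral_of_forall_compl_eq_zero fun x hx => by rw [hθ0 x hx, zero_mul]
  have hint {f : EuclideanSpace ℝ (Fin n) → ℝ} (hf : Continuous f) :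
      Integrable (fun y => θ y * f y) (volume.restrict B) := by
    have hfi : Integrable f (volume.restrict B) :=
      (hf.continuousOn.integrableOn_compact (isCompact_closedBall
        (0 : EuclideanSpace ℝ (Fin n)) 1)).mono_set ball_subset_closedBall
    exact hfi.bdd_mul (c := 1) hθm.aestronglyMeasurable (.of_forall hθ1)
  have hpt (x : EuclideanSpace ℝ (Fin n)) :
      ‖w x - (∫ y, θ y * w y) / m‖ₑ ^ p ≤ M ^ p * ∫⁻ y in B, ‖w x - w y‖ₑ ^ p := by
    have hrep : w x - (∫ y, θ y * w y) / m = m⁻¹ * ∫ y in B, θ y * (w x - w y) := by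
      have h1 : ∫ y in B, θ y * (w x - w y) = w x * m - ∫ y, θ y * w y := by
        simp only [mul_sub]
        rw [integral_sub (hint continuous_const) (hint hcont), hsupp, hsupp, integral_mul_const,
          mul_comm]
      rw [h1]
      field_simp
    have h2 : ‖∫ y in B, θ y * (w x - w y)‖ₑ ≤ ∫⁻ y in B, ‖w x - w y‖ₑ := by
      refine (enorm_integral_le_lintegral_enorm _).trans (lintegral_mono fun y => ?_)
      simp only [enorm_mul]
      refine mul_le_of_le_one_left zero_le ?_
      rw [← ofReal_norm]
      exact ENNReal.ofReal_le_one.2 (hθ1 y)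
    have h3 := eLpNorm'_le_eLpNorm'_mul_rpow_measure_univ (μ := volume.restrict B)
      (f := fun y => w x - w y) one_pos hp1 (by fun_prop)
    simp only [eLpNorm', ENNReal.rpow_one, Measure.restrict_apply_univ] at h3
    have h4 : ‖w x - (∫ y, θ y * w y) / m‖ₑ ≤
        M * (∫⁻ y in B, ‖w x - w y‖ₑ ^ p) ^ (1 / p) := by
      rw [hrep, enorm_mul, Real.enorm_of_nonneg (by positivity), hM, mul_assoc]
      gcongr
      refine h2.trans ?_
      rw [mul_comm]
      simpa using h3
    calc _ ≤ (M * (∫⁻ y in B, ‖w x - w y‖ₑ ^ p) ^ (1 / p)) ^ p := by gcongr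
      _ = _ := by
        rw [ENNReal.mul_rpow_of_nonneg _ _ hp0.le, ← ENNReal.rpow_mul,
          one_div_mul_cancel hp0.ne', ENNReal.rpow_one]
  rw [eLpNorm', eLpNorm', ← ENNReal.mul_rpow_of_nonneg _ _ (by positivity)]
  gcongr
  calc ∫⁻ x in B, ‖w x - (∫ y, θ y * w y) / m‖ₑ ^ p
      ≤ ∫⁻ x in B, M ^ p * ∫⁻ y in B, ‖w x - w y‖ₑ ^ p := lintegral_mono hpt
    _ = M ^ p * ∫⁻ x in B, ∫⁻ y in B, ‖w x - w y‖ₑ ^ p :=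
        lintegral_const_mul' _ _ (ENNReal.rpow_ne_top_of_nonneg hp0.le hMtop)
    _ ≤ M ^ p * (2 ^ p * (2 ^ n * V) * ∫⁻ x in B, ‖fderiv ℝ w x‖ₑ ^ p) := by
        gcongr
        exact lintegral_lintegral_ball_enorm_sub_rpow_le hp1 hw
    _ = _ := by rw [hD]; ring

theorem thetaR_smul (n : ℕ) {R : ℝ} (hR : 0 < R) (x : EuclideanSpace ℝ (Fin n)) :
    thetaR n R (R • x) = thetaR n 1 x := by
  have h1 : ‖R • x‖ = R * ‖x‖ := by rw [norm_smul, Real.norm_of_nonneg hR.le]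
  have h2 : R * ‖x‖ ≤ R / 2 ↔ ‖x‖ ≤ 1 / 2 := by
    rw [div_eq_mul_one_div, mul_le_mul_iff_right₀ hR]
  have h3 : R ≤ R * ‖x‖ ↔ 1 ≤ ‖x‖ := le_mul_iff_one_le_right hR
  have h4 : R / (R * ‖x‖) = 1 / ‖x‖ := by rw [← div_div, div_self hR.ne']
  have h5 : R * ‖x‖ / R = ‖x‖ / 1 := by rw [mul_div_cancel_left₀ _ hR.ne', div_one]
  simp only [thetaR, h1, h2, h3, h4, h5]

theorem thetaR_one_nonneg_and_le_one {n : ℕ} (hn : 2 ≤ n) (x : EuclideanSpace ℝ (Fin n)) :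
    0 ≤ thetaR n 1 x ∧ thetaR n 1 x ≤ 1 := by
  unfold thetaR
  split_ifs with h1 h2 h3
  · simp
  · simp
  · push Not at h1 h2
    have hx : 0 < ‖x‖ := by linarith
    have hlog : 0 < Real.log 2 := Real.log_pos one_lt_two
    refine ⟨div_nonneg (Real.log_nonneg ?_) hlog.le, (div_le_one hlog).2 ?_⟩
    · rw [le_div_iff₀ hx]; linarith
    · refine Real.log_le_log (by positivity) ?_
      rw [div_le_iff₀ hx]; linarith
  · push Not at h1 h2
    have hx : 0 < ‖x‖ := by linarith
    obtain ⟨k, rfl⟩ : ∃ k, n = k + 2 := ⟨n - 2, by omega⟩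
    have hk : k ≠ 0 := by omega
    have e1 : ((k + 2 : ℕ) : ℤ) - 2 = (k : ℤ) := by push_cast; ring
    have e2 : (2 : ℤ) - ((k + 2 : ℕ) : ℤ) = -(k : ℤ) := by push_cast; ring
    rw [e1, e2, div_one, zpow_neg, zpow_natCast, zpow_natCast, ← inv_pow]
    have h2k : (1 : ℝ) < 2 ^ k := one_lt_pow₀ one_lt_two hk
    have hpos : (0 : ℝ) < 2 ^ k - 1 := by linarith
    have hlow : 1 ≤ ‖x‖⁻¹ ^ k := one_le_pow₀ ((one_le_inv₀ hx).2 h2.le)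
    have hupp : ‖x‖⁻¹ ^ k ≤ 2 ^ k := by
      gcongr
      rw [inv_le_comm₀ hx two_pos]
      linarith
    refine ⟨mul_nonneg (inv_nonneg.2 hpos.le) (by linarith), ?_⟩
    rw [inv_mul_le_iff₀ hpos]
    linarith

theorem measurable_thetaR (n : ℕ) (R : ℝ) : Measurable (thetaR n R) := by
  unfold thetaR
  refine Measurable.ite (measurableSet_le (by fun_prop) (by fun_prop)) measurable_const ?_
  refine Measurable.ite (measurableSet_le (by fun_prop) (by fun_prop)) measurable_const ?_
  split_ifs
  · fun_prop
  · fun_prop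

theorem thetaR_one_eq_zero {n : ℕ} {x : EuclideanSpace ℝ (Fin n)}
    (hx : x ∉ ball (0 : EuclideanSpace ℝ (Fin n)) 1) : thetaR n 1 x = 0 := by
  rw [mem_ball_zero_iff, not_lt] at hx
  rw [thetaR, if_neg (by linarith), if_pos hx]

theorem integral_thetaR_one_pos {n : ℕ} (hn : 2 ≤ n) : 0 < ∫ x, thetaR n 1 x := by
  have hint : Integrable (thetaR n 1) := by
    have h : IntegrableOn (thetaR n 1) (ball 0 1) := by
      refine Measure.integrableOn_of_bounded (M := 1) measure_ball_lt_top.ne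
        (measurable_thetaR n 1).aestronglyMeasurable (.of_forall fun x => ?_)
      rw [Real.norm_of_nonneg (thetaR_one_nonneg_and_le_one hn x).1]
      exact (thetaR_one_nonneg_and_le_one hn x).2
    exact (integrableOn_iff_integrable_of_support_subset fun x hx => by
      by_contra h'
      exact hx (thetaR_one_eq_zero h')).1 h
  refine (integral_pos_iff_support_of_nonneg
    (fun x => (thetaR_one_nonneg_and_le_one hn x).1) hint).2 ?_
  refine (measure_ball_pos volume (0 : EuclideanSpace ℝ (Fin n)) one_half_pos).trans_le
    (measure_mono fun x hx => ?_)
  rw [mem_ball_zero_iff] at hx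
  rw [Function.mem_support, thetaR, if_pos hx.le]
  exact one_ne_zero

theorem toReal_eLpNorm' {α F : Type*} [MeasurableSpace α] {μ : Measure α} [NormedAddCommGroup F]
    {f : α → F} {q : ℝ} (hq : 0 < q) (hf : AEStronglyMeasurable f μ) :
    (eLpNorm' f q μ).toReal = (∫ x, ‖f x‖ ^ q ∂μ) ^ (1 / q) := by
  rw [eLpNorm', ← ENNReal.toReal_rpow, integral_eq_lintegral_of_nonneg_ae
    (.of_forall fun x => by positivity) (hf.norm.aemeasurable.pow_const q).aestronglyMeasurable]
  simp only [← ENNReal.ofReal_rpow_of_nonneg (norm_nonneg _) hq.le, ofReal_norm]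

/-- The Sobolev–Poincaré inequality on the unit ball. -/
theorem exists_sobolev_poincare_unit_ball {n : ℕ} (hn : 2 ≤ n) {p : ℝ} (hp1 : 1 ≤ p)
    (hpn : p < n) :
    ∃ C : ℝ, ∀ q : ℝ, 1 ≤ q → q ≤ (n : ℝ) * p / ((n : ℝ) - p) →
      ∀ w : EuclideanSpace ℝ (Fin n) → ℝ, ContDiff ℝ 1 w →
        (∫ x in ball (0 : EuclideanSpace ℝ (Fin n)) 1,
            |w x - (∫ y, thetaR n 1 y * w y) / (∫ y, thetaR n 1 y)| ^ q) ^ (1 / q)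
          ≤ C * (∫ x in ball (0 : EuclideanSpace ℝ (Fin n)) 1, ‖fderiv ℝ w x‖ ^ p) ^ (1 / p) := by
  have hp0 : 0 < p := by linarith
  obtain ⟨C₁, hC₁⟩ := exists_eLpNorm'_ball_le hn hp1 hpn
  obtain ⟨C₂, hC₂⟩ := exists_eLpNorm'_ball_sub_mean_le hp1 (measurable_thetaR n 1)
    (fun x => by
      rw [Real.norm_of_nonneg (thetaR_one_nonneg_and_le_one hn x).1]
      exact (thetaR_one_nonneg_and_le_one hn x).2)
    (fun x hx => thetaR_one_eq_zero hx) (integral_thetaR_one_pos hn)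
  set ν := volume.restrict (ball (0 : EuclideanSpace ℝ (Fin n)) 1) with hν
  set V : ENNReal := max 1 (ν Set.univ) with hV
  have hVtop : V ≠ ⊤ := by
    rw [hV, hν, Measure.restrict_apply_univ]
    exact (max_lt ENNReal.one_lt_top measure_ball_lt_top).ne
  set K : ENNReal := C₁ * (C₂ + 1) * V with hK
  have hKtop : K ≠ ⊤ := by finiteness
  refine ⟨K.toReal, fun q hq1 hqr w hw => ?_⟩
  have hq0 : 0 < q := by linarith
  have hcont := hw.continuous
  have hcont' : Continuous (fderiv ℝ w) := hw.continuous_fderiv one_ne_zero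
  set r := (n : ℝ) * p / (n - p) with hr
  set a := (∫ y, thetaR n 1 y * w y) / ∫ y, thetaR n 1 y with ha
  have hu : ContDiff ℝ 1 fun x => w x - a := hw.sub contDiff_const
  have hfd : fderiv ℝ (fun x => w x - a) = fderiv ℝ w := by
    ext1 x; exact fderiv_sub_const a
  have hVexp : ν Set.univ ^ (1 / q - 1 / r) ≤ V := by
    have h0 : 0 ≤ 1 / q - 1 / r := sub_nonneg.2 (one_div_le_one_div_of_le hq0 hqr)
    have h1 : 1 / q - 1 / r ≤ 1 := by
      have h2 : 1 / q ≤ 1 := (div_le_one hq0).2 hq1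
      have h3 : 0 ≤ 1 / r := one_div_nonneg.2 (hq0.le.trans hqr)
      linarith
    calc ν Set.univ ^ (1 / q - 1 / r) ≤ V ^ (1 / q - 1 / r) := by
          gcongr; exact le_max_right _ _
      _ ≤ V ^ (1 : ℝ) := ENNReal.rpow_le_rpow_of_exponent_le (le_max_left _ _) h1
      _ = V := ENNReal.rpow_one V
  have hmain : eLpNorm' (fun x => w x - a) q ν ≤ K * eLpNorm' (fderiv ℝ w) p ν := by
    calc eLpNorm' (fun x => w x - a) q ν
        ≤ eLpNorm' (fun x => w x - a) r ν * ν Set.univ ^ (1 / q - 1 / r) :=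
          eLpNorm'_le_eLpNorm'_mul_rpow_measure_univ hq0 hqr
            (hcont.sub continuous_const).aestronglyMeasurable
      _ ≤ (C₁ * (C₂ * eLpNorm' (fderiv ℝ w) p ν + eLpNorm' (fderiv ℝ w) p ν)) * V := by
          gcongr
          refine (hC₁ _ hu).trans ?_
          rw [hfd]
          gcongr
          exact hC₂ w hw
      _ = _ := by rw [hK]; ring
  have hfin : eLpNorm' (fderiv ℝ w) p ν ≠ ⊤ := by
    have h := lintegral_ball_enorm_rpow_ne_top hcont'.norm hp0.le
    simp only [enorm_norm] at h
    exact ENNReal.rpow_ne_top_of_nonneg (by positivity) h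
  have h := ENNReal.toReal_mono (ENNReal.mul_ne_top hKtop hfin) hmain
  rw [ENNReal.toReal_mul, toReal_eLpNorm' (f := fun x => w x - a) hq0
      (hcont.sub continuous_const).aestronglyMeasurable,
    toReal_eLpNorm' hp0 hcont'.aestronglyMeasurable] at h
  exact h

theorem setIntegral_ball_eq_pow_mul {n : ℕ} (f : EuclideanSpace ℝ (Fin n) → ℝ) {R : ℝ}
    (hR : 0 < R) :
    ∫ x in ball (0 : EuclideanSpace ℝ (Fin n)) R, f x =
      R ^ n * ∫ x in ball (0 : EuclideanSpace ℝ (Fin n)) 1, f (R • x) := by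
  rw [Measure.setIntegral_comp_smul_of_pos _ _ _ hR, smul_unitBall_of_pos hR,
    finrank_euclideanSpace_fin, smul_eq_mul, mul_inv_cancel_left₀ (by positivity)]

/-- Sobolev–Poincaré inequality with the weighted mean `μ_R(w) = (∫ θ_R w)/(∫ θ_R)`. -/
theorem stmt_0 (n : ℕ) (hn : 2 ≤ n) (p : ℝ) (hp1 : 1 ≤ p) (hpn : p < n) :
    ∃ C : ℝ, ∀ q : ℝ, 1 ≤ q → q ≤ (n : ℝ) * p / ((n : ℝ) - p) →
      ∀ w : EuclideanSpace ℝ (Fin n) → ℝ, ContDiff ℝ 1 w → ∀ R : ℝ, 0 < R →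
        (∫ x in ball (0 : EuclideanSpace ℝ (Fin n)) R,
            |w x - (∫ y, thetaR n R y * w y) / (∫ y, thetaR n R y)| ^ q) ^ (1 / q)
          ≤ C * R ^ (1 + (n : ℝ) / q - (n : ℝ) / p) *
            (∫ x in ball (0 : EuclideanSpace ℝ (Fin n)) R, ‖fderiv ℝ w x‖ ^ p) ^ (1 / p) := by
  obtain ⟨C, hC⟩ := exists_sobolev_poincare_unit_ball hn hp1 hpn
  refine ⟨C, fun q hq1 hqr w hw R hR => ?_⟩
  have hp0 : 0 < p := by linarith
  have hq0 : 0 < q := by linarith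
  have hv : ContDiff ℝ 1 fun x => w (R • x) := hw.comp (contDiff_const_smul R)
  have hmean : (∫ y, thetaR n R y * w y) / (∫ y, thetaR n R y) =
      (∫ y, thetaR n 1 y * w (R • y)) / ∫ y, thetaR n 1 y := by
    have h1 := Measure.integral_comp_smul_of_nonneg (volume : Measure (EuclideanSpace ℝ (Fin n)))
      (fun y => thetaR n R y * w y) R (hR := hR.le)
    have h2 := Measure.integral_comp_smul_of_nonneg (volume : Measure (EuclideanSpace ℝ (Fin n)))
      (thetaR n R) R (hR := hR.le)
    simp only [thetaR_smul n hR, smul_eq_mul] at h1 h2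
    rw [h1, h2, mul_div_mul_left _ _ (by positivity)]
  have hfd (x : EuclideanSpace ℝ (Fin n)) :
      ‖fderiv ℝ (fun y => w (R • y)) x‖ ^ p = R ^ p * ‖fderiv ℝ w (R • x)‖ ^ p := by
    rw [fderiv_comp_smul, norm_smul, Real.norm_of_nonneg hR.le,
      Real.mul_rpow hR.le (norm_nonneg _)]
  have h := hC q hq1 hqr _ hv
  simp only [hfd, integral_const_mul] at h
  rw [hmean, setIntegral_ball_eq_pow_mul _ hR, setIntegral_ball_eq_pow_mul _ hR]
  set J := ∫ x in ball (0 : EuclideanSpace ℝ (Fin n)) 1, ‖fderiv ℝ w (R • x)‖ ^ p with hJ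
  have hJ0 : 0 ≤ J := integral_nonneg fun x => by positivity
  rw [Real.mul_rpow (by positivity) hJ0, ← Real.rpow_mul hR.le, mul_one_div_cancel hp0.ne',
    Real.rpow_one] at h
  rw [Real.mul_rpow (by positivity) (integral_nonneg fun x => by positivity),
    Real.mul_rpow (by positivity) hJ0, ← Real.rpow_natCast_mul hR.le,
    ← Real.rpow_natCast_mul hR.le, mul_one_div, mul_one_div]
  refine (mul_le_mul_of_nonneg_left h (by positivity)).trans_eq ?_
  have hpow : R ^ (1 + (n : ℝ) / q - n / p) * R ^ ((n : ℝ) / p) = R * R ^ ((n : ℝ) / q) := by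
    rw [← Real.rpow_add hR, sub_add_cancel, Real.rpow_add hR, Real.rpow_one]
  linear_combination -(C * J ^ (1 / p)) * hpow
end

section
/- Let 0 < R₀ < R₁. There exist c₀, c₁, c₂, c₃ ∈ ℝ such that the function z(r) = c₀ r³ + c₁ r log r + c₂ r + c₃ r^{−1} satisfies z(R₀) = 1, z(R₁) = −1, z′(R₀) = 0, z′(R₁) = 0, and |z(r)| ≤ 1 for all r ∈ [R₀, R₁], if and only if R₁/R₀ ≤ Q*. (This is the radial form of the statement that in dimension n = 2 an annulus A_{R₀}^{R₁} with constant signature is calibrable if and only if the ratio of the exterior radius over the interior radius is at most Q*.) -/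
/-- The function `m(Q) = log Q − (Q²−1)(2Q−1)/(Q(Q²−2Q+3))` governing calibrability
of annuli in dimension `n = 2`. -/
noncomputable def mfun (Q : ℝ) : ℝ :=
  Real.log Q - (Q ^ 2 - 1) * (2 * Q - 1) / (Q * (Q ^ 2 - 2 * Q + 3))

/-- The radial profile `a r³ + b r log r + c r + d r⁻¹`. -/
noncomputable def profile (a b c d r : ℝ) : ℝ :=
  a * r ^ 3 + b * r * Real.log r + c * r + d * r⁻¹

/-- The derivative of `profile`. -/
noncomputable def profileSlope (a b c d r : ℝ) : ℝ :=
  3 * a * r ^ 2 + b * (Real.log r + 1) + c - d * (r ^ 2)⁻¹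

theorem hasDerivAt_profile (a b c d : ℝ) {r : ℝ} (hr : 0 < r) :
    HasDerivAt (profile a b c d) (profileSlope a b c d r) r := by
  have h1 := ((hasDerivAt_id r).pow 3).const_mul a
  have h2 := ((hasDerivAt_id r).const_mul b).mul (Real.hasDerivAt_log hr.ne')
  have h3 := (hasDerivAt_id r).const_mul c
  have h4 := (hasDerivAt_inv hr.ne').const_mul d
  refine (((h1.add h2).add h3).add h4).congr_deriv ?_
  unfold profileSlope
  simp only [id, Nat.cast_ofNat]
  field_simp
  ring

theorem hasDerivAt_profileSlope (a b c d : ℝ) {r : ℝ} (hr : 0 < r) :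
    HasDerivAt (profileSlope a b c d)
      ((6 * a * (r ^ 2) ^ 2 + b * r ^ 2 + 2 * d) / r ^ 3) r := by
  have h1 := ((hasDerivAt_id r).pow 2).const_mul (3 * a)
  have h2 := ((Real.hasDerivAt_log hr.ne').add_const 1).const_mul b
  have h4 := (((hasDerivAt_id r).pow 2).inv (by simpa using hr.ne')).const_mul d
  refine (((h1.add h2).add_const c).sub h4).congr_deriv ?_
  simp only [id, Nat.cast_ofNat, Pi.pow_apply]
  field_simp
  ring

theorem profile_mul (a b c d : ℝ) {R s : ℝ} (hR : 0 < R) (hs : 0 < s) :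
    profile a b c d (R * s) =
      profile (a * R ^ 3) (b * R) (c * R + b * R * Real.log R) (d / R) s := by
  unfold profile
  rw [Real.log_mul hR.ne' hs.ne']
  field_simp
  ring

theorem profileSlope_mul (a b c d : ℝ) {R s : ℝ} (hR : 0 < R) (hs : 0 < s) :
    R * profileSlope a b c d (R * s) =
      profileSlope (a * R ^ 3) (b * R) (c * R + b * R * Real.log R) (d / R) s := by
  unfold profileSlope
  rw [Real.log_mul hR.ne' hs.ne']
  field_simp
  ring

/-- A real quadratic cannot change sign three times. -/
theorem quadratic_no_three_sign_changes {α β γ x₀ x₁ x₂ x₃ : ℝ}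
    (h01 : x₀ < x₁) (h12 : x₁ < x₂) (h23 : x₂ < x₃)
    (p0 : α * x₀ ^ 2 + β * x₀ + γ ≤ 0) (p1 : 0 < α * x₁ ^ 2 + β * x₁ + γ)
    (p2 : α * x₂ ^ 2 + β * x₂ + γ < 0) (p3 : 0 ≤ α * x₃ ^ 2 + β * x₃ + γ) : False := by
  have q1 : 0 < α * (x₁ + x₀) + β :=
    pos_of_mul_pos_right (a := x₁ - x₀) (by nlinarith) (by linarith)
  have q2 : 0 < -(α * (x₂ + x₁) + β) :=
    pos_of_mul_pos_right (a := x₂ - x₁) (by nlinarith) (by linarith)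
  have q3 : 0 < α * (x₃ + x₂) + β :=
    pos_of_mul_pos_right (a := x₃ - x₂) (by nlinarith) (by linarith)
  have r1 : 0 < -α := pos_of_mul_pos_right (a := x₂ - x₀) (by nlinarith) (by linarith)
  have r2 : 0 < α := pos_of_mul_pos_right (a := x₃ - x₁) (by nlinarith) (by linarith)
  linarith

theorem profileSlope_nonpos {a b c d Q : ℝ}
    (h1 : profileSlope a b c d 1 = 0) (hQ : profileSlope a b c d Q = 0)
    (k1 : 6 * a + b + 2 * d ≤ 0) (kQ : 0 ≤ 6 * a * (Q ^ 2) ^ 2 + b * Q ^ 2 + 2 * d)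
    {s : ℝ} (hs1 : 1 ≤ s) (hsQ : s ≤ Q) : profileSlope a b c d s ≤ 0 := by
  by_contra! hpos
  have hs1' : 1 < s := lt_of_le_of_ne hs1 (by rintro rfl; linarith)
  have hsQ' : s < Q := lt_of_le_of_ne hsQ (by rintro rfl; linarith)
  have hcont (u v : ℝ) (hu : 1 ≤ u) : ContinuousOn (profileSlope a b c d) (Set.Icc u v) :=
    fun x hx => (hasDerivAt_profileSlope a b c d
      (by linarith [hx.1])).continuousAt.continuousWithinAt
  obtain ⟨u, hu, eu⟩ := exists_hasDerivAt_eq_slope (profileSlope a b c d) _ hs1'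
    (hcont 1 s le_rfl)
    (fun x hx => hasDerivAt_profileSlope a b c d (by linarith [hx.1]))
  obtain ⟨v, hv, ev⟩ := exists_hasDerivAt_eq_slope (profileSlope a b c d) _ hsQ'
    (hcont s Q hs1)
    (fun x hx => hasDerivAt_profileSlope a b c d (by linarith [hx.1]))
  have hu0 : 0 < u := by linarith [hu.1]
  have hv0 : 0 < v := by linarith [hv.1]
  have pu : 0 < 6 * a * (u ^ 2) ^ 2 + b * u ^ 2 + 2 * d := by
    have : 0 < (6 * a * (u ^ 2) ^ 2 + b * u ^ 2 + 2 * d) / u ^ 3 := by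
      rw [eu]; exact div_pos (by linarith) (by linarith)
    exact (div_pos_iff_of_pos_right (by positivity)).1 this
  have pv : 6 * a * (v ^ 2) ^ 2 + b * v ^ 2 + 2 * d < 0 := by
    have : (6 * a * (v ^ 2) ^ 2 + b * v ^ 2 + 2 * d) / v ^ 3 < 0 := by
      rw [ev]; exact div_neg_of_neg_of_pos (by linarith) (by linarith)
    by_contra! hn
    exact absurd this (not_lt.2 (by positivity))
  refine quadratic_no_three_sign_changes (x₀ := 1) (x₁ := u ^ 2) (x₂ := v ^ 2) (x₃ := Q ^ 2)
    ?_ ?_ ?_ (by linarith) pu pv kQ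
  · nlinarith [hu.1]
  · nlinarith [hu.2, hv.1]
  · nlinarith [hv.2]

theorem antitoneOn_profile {a b c d Q : ℝ}
    (h1 : profileSlope a b c d 1 = 0) (hQ : profileSlope a b c d Q = 0)
    (k1 : 6 * a + b + 2 * d ≤ 0) (kQ : 0 ≤ 6 * a * (Q ^ 2) ^ 2 + b * Q ^ 2 + 2 * d) :
    AntitoneOn (profile a b c d) (Set.Icc 1 Q) := by
  have hd (x : ℝ) (hx : 1 ≤ x) := hasDerivAt_profile a b c d (r := x) (by linarith)
  refine antitoneOn_of_deriv_nonpos (convex_Icc 1 Q)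
    (fun x hx => (hd x hx.1).continuousAt.continuousWithinAt) ?_ ?_
  · intro x hx
    rw [interior_Icc] at hx
    exact (hd x hx.1.le).differentiableAt.differentiableWithinAt
  · intro x hx
    rw [interior_Icc] at hx
    rw [(hd x hx.1.le).deriv]
    exact profileSlope_nonpos h1 hQ k1 kQ hx.1.le hx.2.le

/-- A profile bounded above on `[1, Q]` by its value at a critical point `1` is not strictly
convex at `1`. -/
theorem curvature_nonpos_of_le {a b c d Q : ℝ} (hQ : 1 < Q)
    (h1 : profileSlope a b c d 1 = 0)
    (hle : ∀ s ∈ Set.Icc 1 Q, profile a b c d s ≤ profile a b c d 1) :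
    6 * a + b + 2 * d ≤ 0 := by
  by_contra! hpos
  have hev : ∀ᶠ s in nhds (1 : ℝ), 0 < 6 * a * (s ^ 2) ^ 2 + b * s ^ 2 + 2 * d :=
    (show Continuous fun s : ℝ => 6 * a * (s ^ 2) ^ 2 + b * s ^ 2 + 2 * d by
      fun_prop).continuousAt.eventually_const_lt (by simpa using hpos)
  obtain ⟨ε, hε, hball⟩ := Metric.eventually_nhds_iff.1 hev
  obtain ⟨t, ht1, ht2⟩ : ∃ t, 1 < t ∧ t < min Q (1 + ε) :=
    exists_between (lt_min hQ (by linarith))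
  have htQ : t < Q := lt_of_lt_of_le ht2 (min_le_left _ _)
  have htε : t < 1 + ε := lt_of_lt_of_le ht2 (min_le_right _ _)
  have hcurv (x : ℝ) (hx1 : 1 < x) (hx2 : x < t) :
      0 < (6 * a * (x ^ 2) ^ 2 + b * x ^ 2 + 2 * d) / x ^ 3 := by
    have h := hball (y := x) (by rw [Real.dist_eq, abs_of_pos] <;> linarith)
    have : 0 < x := by linarith
    positivity
  obtain ⟨u, hu, eu⟩ := exists_hasDerivAt_eq_slope (profile a b c d) _ ht1
    (fun x hx => (hasDerivAt_profile a b c d (by linarith [hx.1])).continuousAt.continuousWithinAt)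
    (fun x hx => hasDerivAt_profile a b c d (by linarith [hx.1]))
  obtain ⟨v, hv, ev⟩ := exists_hasDerivAt_eq_slope (profileSlope a b c d) _ hu.1
    (fun x hx =>
      (hasDerivAt_profileSlope a b c d (by linarith [hx.1])).continuousAt.continuousWithinAt)
    (fun x hx => hasDerivAt_profileSlope a b c d (by linarith [hx.1]))
  have hv' := hcurv v hv.1 (hv.2.trans hu.2)
  rw [ev, h1, sub_zero, div_pos_iff_of_pos_right (by linarith [hu.1]), eu,
    div_pos_iff_of_pos_right (by linarith)] at hv'
  linarith [hle t ⟨ht1.le, htQ.le⟩]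

theorem sq_sub_one_lt_log_mul {Q : ℝ} (hQ : 1 < Q) :
    0 < Real.log Q * (Q ^ 2 + 1) - (Q ^ 2 - 1) := by
  have h := Real.lt_log_one_add_of_pos (x := Q ^ 2 - 1) (by nlinarith)
  rw [show 1 + (Q ^ 2 - 1) = Q ^ 2 by ring, Real.log_pow, div_lt_iff₀ (by nlinarith)] at h
  push_cast at h
  linarith

theorem mfun_denominator_pos {Q : ℝ} (hQ : 0 < Q) : 0 < Q * (Q ^ 2 - 2 * Q + 3) :=
  mul_pos hQ (by nlinarith [sq_nonneg (Q - 1)])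

theorem mfun_mul_denominator {Q : ℝ} (hQ : 0 < Q) :
    Q * (Q ^ 2 - 2 * Q + 3) * mfun Q =
      Q * (Q ^ 2 - 2 * Q + 3) * Real.log Q - (Q ^ 2 - 1) * (2 * Q - 1) := by
  have := (mfun_denominator_pos hQ).ne'
  unfold mfun
  rw [mul_sub, mul_div_cancel₀ _ this]

/-- The boundary data determine the coefficients `a`, `b` and `d` of the profile. -/
theorem boundary_relations {a b c d Q : ℝ} (hQ : 1 < Q)
    (v1 : profile a b c d 1 = 1) (vQ : profile a b c d Q = -1)
    (s1 : profileSlope a b c d 1 = 0) (sQ : profileSlope a b c d Q = 0) :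
    b = 2 * d - 2 * a - 1 ∧ 2 * (Q - 1) * (a * Q ^ 2 + d) = Q ∧
      4 * a * Q * (Q - 1) * (Real.log Q * (Q ^ 2 + 1) - (Q ^ 2 - 1)) =
        2 * Q * Real.log Q + Q ^ 2 - 1 := by
  have hQ0 : 0 < Q := by linarith
  simp only [profile, profileSlope, Real.log_one, one_pow, inv_one] at v1 s1
  have hc : c = 1 - a - d := by linarith
  have hb : b = 2 * d - 2 * a - 1 := by linarith
  unfold profile at vQ
  unfold profileSlope at sQ
  subst hb hc
  field_simp at vQ sQ
  have hK : 2 * (Q - 1) * (a * Q ^ 2 + d) = Q := by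
    refine mul_left_cancel₀ (show Q + 1 ≠ 0 by linarith) ?_
    linear_combination sQ - vQ
  refine ⟨rfl, hK, ?_⟩
  refine mul_left_cancel₀ hQ0.ne' ?_
  linear_combination (-2) * (Q - 1) * vQ + (2 * Q ^ 2 * Real.log Q - Q ^ 2 + 1) * hK

theorem curvature_mul_eq {a b d Q : ℝ} (hQ : 1 < Q)
    (hb : b = 2 * d - 2 * a - 1) (hK : 2 * (Q - 1) * (a * Q ^ 2 + d) = Q)
    (ha : 4 * a * Q * (Q - 1) * (Real.log Q * (Q ^ 2 + 1) - (Q ^ 2 - 1)) =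
        2 * Q * Real.log Q + Q ^ 2 - 1) :
    Q * (Q - 1) * (Real.log Q * (Q ^ 2 + 1) - (Q ^ 2 - 1)) * (6 * a + b + 2 * d) =
      (Q + 1) * (Q * (Q ^ 2 - 2 * Q + 3) * mfun Q) := by
  rw [mfun_mul_denominator (by linarith)]
  subst hb
  linear_combination 2 * Q * (Real.log Q * (Q ^ 2 + 1) - (Q ^ 2 - 1)) * hK - (Q ^ 2 - 1) * ha

theorem curvature_nonpos_iff {a b d Q : ℝ} (hQ : 1 < Q)
    (hb : b = 2 * d - 2 * a - 1) (hK : 2 * (Q - 1) * (a * Q ^ 2 + d) = Q)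
    (ha : 4 * a * Q * (Q - 1) * (Real.log Q * (Q ^ 2 + 1) - (Q ^ 2 - 1)) =
        2 * Q * Real.log Q + Q ^ 2 - 1) :
    6 * a + b + 2 * d ≤ 0 ↔ mfun Q ≤ 0 := by
  have hQ0 : 0 < Q := by linarith
  have hE := sq_sub_one_lt_log_mul hQ
  have hP : 0 < Q * (Q - 1) * (Real.log Q * (Q ^ 2 + 1) - (Q ^ 2 - 1)) :=
    mul_pos (mul_pos hQ0 (by linarith)) hE
  have hD := mfun_denominator_pos hQ0
  have h := curvature_mul_eq hQ hb hK ha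
  rw [← mul_assoc] at h
  rw [← not_lt, ← not_lt, not_iff_not, ← mul_pos_iff_of_pos_left hP, h,
    mul_pos_iff_of_pos_left (by positivity)]

/-- Profiles on `[1, Q]` with the calibration boundary data and bound exist iff `mfun Q ≤ 0`. -/
theorem exists_profile_iff {Q : ℝ} (hQ : 1 < Q) :
    (∃ a b c d : ℝ, profile a b c d 1 = 1 ∧ profile a b c d Q = -1 ∧
      profileSlope a b c d 1 = 0 ∧ profileSlope a b c d Q = 0 ∧
      ∀ s ∈ Set.Icc 1 Q, |profile a b c d s| ≤ 1) ↔ mfun Q ≤ 0 := by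
  have hQ0 : 0 < Q := by linarith
  constructor
  · rintro ⟨a, b, c, d, v1, vQ, s1, sQ, hbd⟩
    obtain ⟨hb, hK, ha⟩ := boundary_relations hQ v1 vQ s1 sQ
    refine (curvature_nonpos_iff hQ hb hK ha).1 (curvature_nonpos_of_le hQ s1 fun s hs => ?_)
    rw [v1]
    exact (abs_le.1 (hbd s hs)).2
  · intro hm
    have hE := sq_sub_one_lt_log_mul hQ
    have hL := Real.log_pos hQ
    have hQ1 : 0 < Q - 1 := by linarith
    have hden : 0 < 4 * Q * (Q - 1) * (Real.log Q * (Q ^ 2 + 1) - (Q ^ 2 - 1)) := by positivity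
    obtain ⟨a, ha⟩ : ∃ a : ℝ, a * (4 * Q * (Q - 1) * (Real.log Q * (Q ^ 2 + 1) - (Q ^ 2 - 1))) =
        2 * Q * Real.log Q + Q ^ 2 - 1 := ⟨_, div_mul_cancel₀ _ hden.ne'⟩
    obtain ⟨d, hd⟩ : ∃ d : ℝ, d = Q / (2 * (Q - 1)) - a * Q ^ 2 := ⟨_, rfl⟩
    have hK : 2 * (Q - 1) * (a * Q ^ 2 + d) = Q := by
      rw [hd]; field_simp; ring
    have ha0 : 0 < a := by
      refine pos_of_mul_pos_left (b := 4 * Q * (Q - 1) *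
        (Real.log Q * (Q ^ 2 + 1) - (Q ^ 2 - 1))) ?_ hden.le
      rw [ha]
      nlinarith [mul_pos hQ0 hL]
    have ha' : 4 * a * Q * (Q - 1) * (Real.log Q * (Q ^ 2 + 1) - (Q ^ 2 - 1)) =
        2 * Q * Real.log Q + Q ^ 2 - 1 := by linear_combination ha
    have v1 : profile a (2 * d - 2 * a - 1) (1 - a - d) d 1 = 1 := by
      simp [profile]; ring
    have s1 : profileSlope a (2 * d - 2 * a - 1) (1 - a - d) d 1 = 0 := by
      simp [profileSlope]; ring
    have hv : a * Q ^ 4 + (2 * d - 2 * a - 1) * Q ^ 2 * Real.log Q + (1 - a - d) * Q ^ 2 + d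
        = -Q := by
      refine mul_left_cancel₀ (show 2 * (Q - 1) ≠ 0 by positivity) ?_
      linear_combination (2 * Q ^ 2 * Real.log Q - Q ^ 2 + 1) * hK - Q * ha'
    have vQ : profile a (2 * d - 2 * a - 1) (1 - a - d) d Q = -1 := by
      unfold profile
      refine mul_left_cancel₀ hQ0.ne' ?_
      have : Q * Q⁻¹ = 1 := mul_inv_cancel₀ hQ0.ne'
      linear_combination hv + d * this
    have sQ : profileSlope a (2 * d - 2 * a - 1) (1 - a - d) d Q = 0 := by
      unfold profileSlope
      refine mul_left_cancel₀ (show Q ^ 2 ≠ 0 by positivity) ?_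
      have : Q ^ 2 * (Q ^ 2)⁻¹ = 1 := mul_inv_cancel₀ (by positivity)
      linear_combination hv + (Q + 1) * hK - d * this
    have hanti := antitoneOn_profile s1 sQ ((curvature_nonpos_iff hQ rfl hK ha').2 hm) (by
      refine le_of_mul_le_mul_left (a := Q - 1) ?_ hQ1
      have h1 : 0 < 4 * a * Q ^ 2 * (Q ^ 2 - 1) * (Q - 1) := by
        have : 0 < Q ^ 2 - 1 := by nlinarith
        positivity
      have h2 : 0 < Q * (Q + 1) := by positivity
      linear_combination h1 + h2 - (Q ^ 2 + 1) * hK)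
    refine ⟨a, _, _, d, v1, vQ, s1, sQ, fun s hs => abs_le.2 ⟨?_, ?_⟩⟩
    · exact vQ.symm.trans_le (hanti hs (Set.right_mem_Icc.2 hQ.le) hs.2)
    · exact (hanti (Set.left_mem_Icc.2 hQ.le) hs hs.1).trans_eq v1

theorem mfun_neg_of_le_three {q : ℝ} (h1 : 1 < q) (h3 : q ≤ 3) : mfun q < 0 := by
  have hq : 0 < q := by linarith
  have hD := mfun_denominator_pos hq
  unfold mfun
  rw [sub_neg, lt_div_iff₀ hD]
  have hl := Real.log_le_sub_one_of_pos hq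
  have h := mul_le_mul_of_nonneg_right hl hD.le
  have : 0 < (q - 1) ^ 2 * (1 + q * (3 - q)) :=
    mul_pos (by nlinarith) (by nlinarith [mul_nonneg hq.le (sub_nonneg.2 h3)])
  linear_combination h + this

theorem mfun_pos_of_exp_five_le {q : ℝ} (h : Real.exp 5 ≤ q) : 0 < mfun q := by
  have hq : 0 < q := (Real.exp_pos 5).trans_le h
  have hq1 : 1 < q := by linarith [Real.add_one_le_exp (5 : ℝ)]
  have hD := mfun_denominator_pos hq
  have hl : 5 ≤ Real.log q := (Real.le_log_iff_exp_le hq).2 h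
  unfold mfun
  rw [sub_pos, div_lt_iff₀ hD]
  nlinarith [mul_le_mul_of_nonneg_right hl hD.le, mul_pos hq (pow_pos (sub_pos.2 hq1) 2)]

theorem continuousOn_mfun : ContinuousOn mfun (Set.Ioi 0) := by
  unfold mfun
  refine ContinuousOn.sub (Real.continuousOn_log.mono fun x hx => (ne_of_gt hx)) ?_
  exact ContinuousOn.div (by fun_prop) (by fun_prop) fun x hx => (mfun_denominator_pos hx).ne'

theorem mfun_nonpos_iff {Qs : ℝ}
    (hQsu : ∀ Q : ℝ, 1 < Q → mfun Q = 0 → Q = Qs) {Q : ℝ} (hQ : 1 < Q) :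
    mfun Q ≤ 0 ↔ Q ≤ Qs := by
  have hzero {u v : ℝ} (hu : 1 < u) (huv : u ≤ v) (mu : mfun u < 0) (mv : 0 < mfun v) :
      u < Qs ∧ Qs < v := by
    obtain ⟨x, hx, hx0⟩ := intermediate_value_Ioo huv
      (continuousOn_mfun.mono fun y hy => (by linarith [hy.1] : (0 : ℝ) < y)) ⟨mu, mv⟩
    rw [← hQsu x (hu.trans hx.1) hx0]
    exact hx
  constructor
  · intro hm
    rcases hm.eq_or_lt with h | h
    · exact (hQsu Q hQ h).le
    · exact (hzero hQ (le_max_left Q (Real.exp 5)) h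
        (mfun_pos_of_exp_five_le (le_max_right _ _))).1.le
  · intro hle
    by_contra! hm
    have h1 : 1 < min Q 3 := lt_min hQ (by norm_num)
    exact absurd (hzero h1 (min_le_left _ _) (mfun_neg_of_le_three h1 (min_le_right _ _)) hm).2
      hle.not_gt

/-- In dimension `n = 2`, an annulus `A_{R₀}^{R₁}` with constant signature is calibrable
(there is a radial profile `z(r) = c₀ r³ + c₁ r log r + c₂ r + c₃ r⁻¹` with
`z(R₀) = 1`, `z(R₁) = −1`, `z′(R₀) = z′(R₁) = 0`, `|z| ≤ 1` on `[R₀,R₁]`)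
if and only if `R₁/R₀ ≤ Q*`, where `Q*` is the unique zero of `m` in `(1,∞)`. -/
theorem stmt_10 (R0 R1 : ℝ) (h0 : 0 < R0) (h01 : R0 < R1)
    (Qs : ℝ) (hQs1 : 1 < Qs) (hQs0 : mfun Qs = 0)
    (hQsu : ∀ Q : ℝ, 1 < Q → mfun Q = 0 → Q = Qs) :
    (∃ c0 c1 c2 c3 : ℝ, ∃ z : ℝ → ℝ,
      z = (fun r => c0 * r ^ 3 + c1 * r * Real.log r + c2 * r + c3 * r⁻¹) ∧
      z R0 = 1 ∧ z R1 = -1 ∧ deriv z R0 = 0 ∧ deriv z R1 = 0 ∧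
      ∀ r ∈ Set.Icc R0 R1, |z r| ≤ 1) ↔ R1 / R0 ≤ Qs := by
  have hQ : 1 < R1 / R0 := (one_lt_div h0).2 h01
  have hR1 : R0 * (R1 / R0) = R1 := mul_div_cancel₀ _ h0.ne'
  have hQ0 : 0 < R1 / R0 := by linarith
  rw [← mfun_nonpos_iff hQsu hQ, ← exists_profile_iff hQ]
  constructor
  · rintro ⟨c0, c1, c2, c3, z, hz, v0, v1, s0, s1, hbd⟩
    obtain rfl : z = profile c0 c1 c2 c3 := hz
    rw [(hasDerivAt_profile c0 c1 c2 c3 h0).deriv] at s0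
    rw [(hasDerivAt_profile c0 c1 c2 c3 (h0.trans h01)).deriv] at s1
    refine ⟨c0 * R0 ^ 3, c1 * R0, c2 * R0 + c1 * R0 * Real.log R0, c3 / R0, ?_, ?_, ?_, ?_, ?_⟩
    · rw [← profile_mul _ _ _ _ h0 one_pos, mul_one, v0]
    · rw [← profile_mul _ _ _ _ h0 hQ0, hR1, v1]
    · rw [← profileSlope_mul _ _ _ _ h0 one_pos, mul_one, s0, mul_zero]
    · rw [← profileSlope_mul _ _ _ _ h0 hQ0, hR1, s1, mul_zero]
    · intro s hs
      rw [← profile_mul _ _ _ _ h0 (by linarith [hs.1])]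
      refine hbd _ ⟨le_mul_of_one_le_right h0.le hs.1, ?_⟩
      rw [← hR1]
      exact mul_le_mul_of_nonneg_left hs.2 h0.le
  · rintro ⟨a, b, c, d, v0, v1, s0, s1, hbd⟩
    have hi : 0 < R0⁻¹ := inv_pos.2 h0
    have hscale {r : ℝ} (hr : 0 < r) := profile_mul a b c d hi hr
    have hslope {r : ℝ} (hr : 0 < r) := profileSlope_mul a b c d hi hr
    have hR1' : R0⁻¹ * R1 = R1 / R0 := by rw [mul_comm, div_eq_mul_inv]
    have hR0' : R0⁻¹ * R0 = 1 := inv_mul_cancel₀ h0.ne'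
    refine ⟨_, _, _, _, profile (a * R0⁻¹ ^ 3) (b * R0⁻¹)
      (c * R0⁻¹ + b * R0⁻¹ * Real.log R0⁻¹) (d / R0⁻¹), rfl, ?_, ?_, ?_, ?_, ?_⟩
    · rw [← hscale h0, hR0', v0]
    · rw [← hscale (h0.trans h01), hR1', v1]
    · rw [(hasDerivAt_profile _ _ _ _ h0).deriv, ← hslope h0, hR0', s0, mul_zero]
    · rw [(hasDerivAt_profile _ _ _ _ (h0.trans h01)).deriv, ← hslope (h0.trans h01), hR1', s1,
        mul_zero]
    · intro r hr
      rw [← hscale (h0.trans_le hr.1)]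
      refine hbd _ ⟨?_, ?_⟩
      · rw [← hR0']
        exact mul_le_mul_of_nonneg_left hr.1 hi.le
      · rw [← hR1']
        exact mul_le_mul_of_nonneg_left hr.2 hi.le
end

section
/- Let 0 < R₀ < R₁. There exist no real numbers c₀, c₁, c₂, c₃ such that the function z(r) = c₀ r³ + c₁ r log r + c₂ r + c₃ r^{−1} satisfies z(R₀) = −1, z(R₁) = −1, z′(R₀) = 0, z′(R₁) = 0, and |z(r)| ≤ 1 for all r ∈ [R₀, R₁]. (This is the radial form of the statement that in dimension n = 2 no annulus with non-constant signature is calibrable: the unique solution of the boundary value problem satisfies z < −1 in the interior.) -/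
/-- Mean value theorem on the positive half-line for a derivative of the form `w * g` with a
positive weight `w`: some value of `g` has the sign of the increment of `f`. -/
lemma exists_pos_mul_eq_sub {f w g : ℝ → ℝ} (hw : ∀ x, 0 < x → 0 < w x)
    (hf : ∀ x, 0 < x → HasDerivAt f (w x * g x) x) {a b : ℝ} (ha : 0 < a) (hab : a < b) :
    ∃ c, a < c ∧ c < b ∧ ∃ k, 0 < k ∧ k * g c = f b - f a := by
  obtain ⟨c, hc, h⟩ := exists_hasDerivAt_eq_slope f (fun x => w x * g x) hab
    (fun x hx => (hf x (ha.trans_le hx.1)).continuousAt.continuousWithinAt)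
    (fun x hx => hf x (ha.trans hx.1))
  have hba : 0 < b - a := sub_pos.2 hab
  refine ⟨c, hc.1, hc.2, (b - a) * w c, mul_pos hba (hw c (ha.trans hc.1)), ?_⟩
  rw [eq_div_iff hba.ne'] at h
  linarith

lemma exists_nonneg_of_le {f w g : ℝ → ℝ} (hw : ∀ x, 0 < x → 0 < w x)
    (hf : ∀ x, 0 < x → HasDerivAt f (w x * g x) x) {a b : ℝ} (ha : 0 < a) (hab : a < b)
    (h : f a ≤ f b) : ∃ c, a < c ∧ c < b ∧ 0 ≤ g c := by
  obtain ⟨c, hac, hcb, k, hk, hkc⟩ := exists_pos_mul_eq_sub hw hf ha hab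
  exact ⟨c, hac, hcb, nonneg_of_mul_nonneg_right (by linarith) hk⟩

lemma exists_nonpos_of_le {f w g : ℝ → ℝ} (hw : ∀ x, 0 < x → 0 < w x)
    (hf : ∀ x, 0 < x → HasDerivAt f (w x * g x) x) {a b : ℝ} (ha : 0 < a) (hab : a < b)
    (h : f b ≤ f a) : ∃ c, a < c ∧ c < b ∧ g c ≤ 0 := by
  obtain ⟨c, hac, hcb, k, hk, hkc⟩ := exists_pos_mul_eq_sub hw hf ha hab
  exact ⟨c, hac, hcb, by by_contra! hg; nlinarith [mul_pos hk hg]⟩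

/-- In dimension `n = 2`, no annulus with non-constant signature is calibrable: there are
no constants such that `z(r) = c₀ r³ + c₁ r log r + c₂ r + c₃ r⁻¹` satisfies
`z(R₀) = −1`, `z(R₁) = −1`, `z′(R₀) = z′(R₁) = 0` and `|z| ≤ 1` on `[R₀, R₁]`. -/
theorem stmt_11 (R0 R1 : ℝ) (h0 : 0 < R0) (h01 : R0 < R1) :
    ¬ ∃ c0 c1 c2 c3 : ℝ, ∃ z : ℝ → ℝ,
      z = (fun r => c0 * r ^ 3 + c1 * r * Real.log r + c2 * r + c3 * r⁻¹) ∧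
      z R0 = -1 ∧ z R1 = -1 ∧ deriv z R0 = 0 ∧ deriv z R1 = 0 ∧
      ∀ r ∈ Set.Icc R0 R1, |z r| ≤ 1 := by
  rintro ⟨c0, c1, c2, c3, z, hz, hz0, hz1, hd0, hd1, hb⟩
  -- Successive weighted derivatives of `r * (z r + 1)`, each annihilating one basis function.
  let f : ℝ → ℝ := fun r => r * (z r + 1)
  let g : ℝ → ℝ := fun r => r⁻¹ + 4 * c0 * r ^ 2 + 2 * c1 * Real.log r + (c1 + 2 * c2)
  let p : ℝ → ℝ := fun r => -r⁻¹ + 8 * c0 * r ^ 2 + 2 * c1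
  let q : ℝ → ℝ := fun r => (r ^ 3)⁻¹ + 16 * c0
  have hzd : ∀ r, 0 < r → DifferentiableAt ℝ z r := by
    intro r hr
    have := hr.ne'
    rw [hz]
    fun_prop (disch := assumption)
  have hz' : ∀ r, 0 < r → z r + 1 + r * deriv z r = r * g r := by
    intro r hr
    have hd : HasDerivAt z (c0 * (3 * r ^ 2) + (c1 * Real.log r + c1 * r * r⁻¹) + c2
        + c3 * (-(r ^ 2)⁻¹)) r := by
      rw [hz]
      have := ((((hasDerivAt_pow 3 r).const_mul c0).add
        (((hasDerivAt_id r).const_mul c1).mul (Real.hasDerivAt_log hr.ne'))).add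
        ((hasDerivAt_id r).const_mul c2)).add ((hasDerivAt_inv hr.ne').const_mul c3)
      refine this.congr_deriv ?_
      simp
    rw [hd.deriv, hz]
    simp only [g]
    field_simp
    ring
  have hf : ∀ r, 0 < r → HasDerivAt f (r * g r) r := by
    intro r hr
    rw [← hz' r hr]
    refine ((hasDerivAt_id r).mul ((hzd r hr).hasDerivAt.add_const 1)).congr_deriv ?_
    simp
  have hg : ∀ r, 0 < r → HasDerivAt g (r⁻¹ * p r) r := by
    intro r hr
    have := (((hasDerivAt_inv hr.ne').add ((hasDerivAt_pow 2 r).const_mul (4 * c0))).add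
      ((Real.hasDerivAt_log hr.ne').const_mul (2 * c1))).add_const (c1 + 2 * c2)
    refine this.congr_deriv ?_
    simp only [p]
    field_simp
    ring
  have hp : ∀ r, 0 < r → HasDerivAt p (r * q r) r := by
    intro r hr
    have := ((hasDerivAt_inv hr.ne').neg.add
      ((hasDerivAt_pow 2 r).const_mul (8 * c0))).add_const (2 * c1)
    refine this.congr_deriv ?_
    simp only [q]
    field_simp
    ring
  have hid : ∀ r : ℝ, 0 < r → 0 < r := fun _ hr => hr
  have hinv : ∀ r : ℝ, 0 < r → 0 < r⁻¹ := fun _ hr => inv_pos.2 hr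
  have hR1 : 0 < R1 := h0.trans h01
  have hf0 : f R0 = 0 := by simp [f, hz0]
  have hf1 : f R1 = 0 := by simp [f, hz1]
  have hg0 : g R0 = 0 := by
    have := hz' R0 h0
    rw [hz0, hd0] at this
    simpa [h0.ne'] using this.symm
  have hg1 : g R1 = 0 := by
    have := hz' R1 hR1
    rw [hz1, hd1] at this
    simpa [hR1.ne'] using this.symm
  obtain ⟨m, hm0, hm1⟩ := exists_between h01
  have hm : 0 < m := h0.trans hm0
  have hfm : 0 ≤ f m :=
    mul_nonneg hm.le (by linarith [(abs_le.1 (hb m ⟨hm0.le, hm1.le⟩)).1])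
  obtain ⟨a, ha0, ham, hga⟩ := exists_nonneg_of_le hid hf h0 hm0 (hf0.trans_le hfm)
  obtain ⟨b, hmb, hb1, hgb⟩ := exists_nonpos_of_le hid hf hm hm1 (hf1.trans_le hfm)
  have ha : 0 < a := h0.trans ha0
  obtain ⟨x, hx0, hxa, hpx⟩ := exists_nonneg_of_le hinv hg h0 ha0 (hg0.trans_le hga)
  obtain ⟨y, hay, hyb, hpy⟩ :=
    exists_nonpos_of_le hinv hg ha (ham.trans hmb) (hgb.trans hga)
  obtain ⟨t, hbt, -, hpt⟩ :=
    exists_nonneg_of_le hinv hg (hm.trans hmb) hb1 (hgb.trans hg1.ge)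
  obtain ⟨u, hxu, huy, hqu⟩ :=
    exists_nonpos_of_le hid hp (h0.trans hx0) (hxa.trans hay) (hpy.trans hpx)
  obtain ⟨v, hyv, -, hqv⟩ :=
    exists_nonneg_of_le hid hp (ha.trans hay) (hyb.trans hbt) (hpy.trans hpt)
  have hu : 0 < u := (h0.trans hx0).trans hxu
  have huv : u ^ 3 < v ^ 3 := pow_lt_pow_left₀ (huy.trans hyv) hu.le (by norm_num)
  have hlt : (v ^ 3)⁻¹ < (u ^ 3)⁻¹ := inv_strictAnti₀ (pow_pos hu 3) huv
  simp only [q] at hqu hqv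
  linarith
end
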